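/- Let k be a field, R = k[[x,y]]/(x^2), and for an integer n ≥ 1 let I_n = (x, y^n) be the ideal of R generated by the residue classes of x and y^n. Then there is a short exact sequence 0 → I_n → R^{⊕2} → I_n → 0 of R-modules, and consequently R^{⊕2} ⇒_deg I_n^{⊕2}. -/

import Mathlib

open Polynomial TensorProduct

noncomputable section

/-- The prime ideal `(t)` of the polynomial ring `k[t]`. -/
def tIdeal (k : Type) [Field k] : Ideal (Polynomial k) := Ideal.span {Polynomial.X}

instance tIdeal_isPrime (k : Type) [Field k] : (tIdeal k).IsPrime := by
  have h : tIdeal k = RingHom.ker (Polynomial.evalRingHom (0 : k)) := by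
    rw [Polynomial.ker_evalRingHom]
    simp [tIdeal]
  rw [h]
  exact RingHom.ker_isPrime _

/-- `V = k[t]_{(t)}`, the localization of the polynomial ring `k[t]` at the prime ideal `(t)`. -/
def DegV (k : Type) [Field k] : Type := Localization.AtPrime (tIdeal k)

instance (k : Type) [Field k] : CommRing (DegV k) :=
  inferInstanceAs (CommRing (Localization.AtPrime (tIdeal k)))

instance (k : Type) [Field k] : Algebra (Polynomial k) (DegV k) :=
  inferInstanceAs (Algebra (Polynomial k) (Localization.AtPrime (tIdeal k)))

instance (k : Type) [Field k] : Algebra k (DegV k) :=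
  inferInstanceAs (Algebra k (Localization.AtPrime (tIdeal k)))

instance (k : Type) [Field k] : IsScalarTower k (Polynomial k) (DegV k) :=
  inferInstanceAs (IsScalarTower k (Polynomial k) (Localization.AtPrime (tIdeal k)))

/-- The element `t` of `V = k[t]_{(t)}`. -/
def degT (k : Type) [Field k] : DegV k := algebraMap (Polynomial k) (DegV k) Polynomial.X

/-- `K = V[t⁻¹]`, which is the fraction field `k(t)` of `V = k[t]_{(t)}`. -/
def DegK (k : Type) [Field k] : Type := Localization (Submonoid.powers (degT k))

instance (k : Type) [Field k] : CommRing (DegK k) :=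
  inferInstanceAs (CommRing (Localization (Submonoid.powers (degT k))))

instance (k : Type) [Field k] : Algebra (DegV k) (DegK k) :=
  inferInstanceAs (Algebra (DegV k) (Localization (Submonoid.powers (degT k))))

instance (k : Type) [Field k] : Algebra k (DegK k) :=
  inferInstanceAs (Algebra k (Localization (Submonoid.powers (degT k))))

/-- The localized module `Q[t⁻¹]` is a module over `K = V[t⁻¹]`. -/
instance (k : Type) [Field k] (Q : Type) [AddCommGroup Q] [Module (DegV k) Q] :
    Module (DegK k) (LocalizedModule (Submonoid.powers (degT k)) Q) :=
  inferInstanceAs (Module (Localization (Submonoid.powers (degT k)))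
    (LocalizedModule (Submonoid.powers (degT k)) Q))

section

variable (k : Type) [Field k] (R : Type) [Ring R] [Algebra k R]

/-- `1 ⊗ t` is central in `R ⊗[k] V`. -/
theorem degT_central (x : R ⊗[k] DegV k) :
    x * ((1 : R) ⊗ₜ[k] degT k) = ((1 : R) ⊗ₜ[k] degT k) * x := by
  induction x with
  | zero => simp
  | tmul a v => simp [Algebra.TensorProduct.tmul_mul_tmul, mul_comm]
  | add x y hx hy => simp [add_mul, mul_add, hx, hy]

/-- Multiplication by `1 ⊗ t` on an `R ⊗[k] V`-module, as an `R ⊗[k] V`-linear map. -/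
def tSmul (Q : Type) [AddCommGroup Q] [Module (R ⊗[k] DegV k) Q] :
    Q →ₗ[R ⊗[k] DegV k] Q where
  toFun q := ((1 : R) ⊗ₜ[k] degT k) • q
  map_add' := smul_add _
  map_smul' x q := by
    simp only [RingHom.id_apply, ← mul_smul, degT_central]

/-- The `R`-module structure on an `R ⊗[k] V`-module obtained by restriction of scalars
along `R → R ⊗[k] V`. -/
def rRestrict (Q : Type) [AddCommGroup Q] [Module (R ⊗[k] DegV k) Q] : Module R Q :=
  Module.compHom Q (Algebra.TensorProduct.includeLeftRingHom : R →+* R ⊗[k] DegV k)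

/-- The `V`-module structure on an `R ⊗[k] V`-module obtained by restriction of scalars
along `V → R ⊗[k] V`. -/
def vRestrict (Q : Type) [AddCommGroup Q] [Module (R ⊗[k] DegV k) Q] : Module (DegV k) Q :=
  Module.compHom Q
    ((Algebra.TensorProduct.includeRight : DegV k →ₐ[k] R ⊗[k] DegV k) : DegV k →+* R ⊗[k] DegV k)

/-- The action of `r : R` on an `R ⊗[k] V`-module `Q`, as a `V`-linear endomorphism of `Q`. -/
def rAct (Q : Type) [AddCommGroup Q] [Module (R ⊗[k] DegV k) Q] (r : R) :
    letI := vRestrict k R Q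
    Q →ₗ[DegV k] Q :=
  letI := vRestrict k R Q
  { toFun := fun q => (r ⊗ₜ[k] (1 : DegV k)) • q
    map_add' := smul_add _
    map_smul' := fun v q => by
      show (r ⊗ₜ[k] (1 : DegV k)) • (((1 : R) ⊗ₜ[k] v) • q)
        = ((1 : R) ⊗ₜ[k] v) • ((r ⊗ₜ[k] (1 : DegV k)) • q)
      rw [← mul_smul, ← mul_smul, Algebra.TensorProduct.tmul_mul_tmul,
        Algebra.TensorProduct.tmul_mul_tmul, one_mul, mul_one, one_mul, mul_one] }

/-- The action of `r : R` on a module `M`, as a `k`-linear endomorphism of `M`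
(where `M` is viewed as a `k`-module by restriction of scalars along `k → R`). -/
def rActK (M : Type) [AddCommGroup M] [Module R M] (r : R) :
    letI := Module.compHom M (algebraMap k R)
    M →ₗ[k] M :=
  letI := Module.compHom M (algebraMap k R)
  { toFun := fun m => r • m
    map_add' := smul_add r
    map_smul' := fun c m => by
      show r • ((algebraMap k R c) • m) = (algebraMap k R c) • (r • m)
      rw [← mul_smul, ← mul_smul, Algebra.commutes] }

/-- Degeneration of modules (Yoshino): `M ⇒_deg N` iff there is a finitely generated
`R ⊗[k] V`-module `Q`, flat over `V`, with `Q/tQ ≅ N` as `R`-modules and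
`Q_t = Q[t⁻¹] ≅ M ⊗[k] K` compatibly with the `R`- and `K`-actions
(i.e. as `R ⊗[k] K`-modules). -/
def Degenerates (M N : Type) [AddCommGroup M] [Module R M] [AddCommGroup N] [Module R N] :
    Prop :=
  ∃ (Q : Type) (_ : AddCommGroup Q) (_ : Module (R ⊗[k] DegV k) Q),
    Module.Finite (R ⊗[k] DegV k) Q ∧
    (letI := vRestrict k R Q; Module.Flat (DegV k) Q) ∧
    -- `Q/tQ ≅ N` as `R`-modules
    (letI := rRestrict k R (Q ⧸ LinearMap.range (tSmul k R Q))
     Nonempty ((Q ⧸ LinearMap.range (tSmul k R Q)) ≃ₗ[R] N)) ∧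
    -- `Q_t ≅ M ⊗_k K` as `R ⊗_k K`-modules, i.e. compatibly with both actions
    (letI := vRestrict k R Q
     letI : Module k M := Module.compHom M (algebraMap k R)
     ∃ f : LocalizedModule (Submonoid.powers (degT k)) Q ≃+ (M ⊗[k] DegK k),
       (∀ (c : DegK k) (x : LocalizedModule (Submonoid.powers (degT k)) Q),
          f (c • x) = LinearMap.lTensor M (LinearMap.mulLeft k c) (f x)) ∧
       (∀ (r : R) (x : LocalizedModule (Submonoid.powers (degT k)) Q),
          f (LocalizedModule.map (Submonoid.powers (degT k)) (rAct k R Q r) x)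
            = LinearMap.rTensor (DegK k) (rActK k R M r) (f x)))

end

/-- The ring `R = k[[x,y]]/(x²)`. -/
abbrev AinfRing (k : Type) [Field k] : Type :=
  MvPowerSeries (Fin 2) k ⧸ Ideal.span {(MvPowerSeries.X (0 : Fin 2) : MvPowerSeries (Fin 2) k) ^ 2}

/-- The residue class of `x` in `R = k[[x,y]]/(x²)`. -/
def ax (k : Type) [Field k] : AinfRing k := Ideal.Quotient.mk _ ((MvPowerSeries.X (0 : Fin 2) : MvPowerSeries (Fin 2) k))

/-- The residue class of `y` in `R = k[[x,y]]/(x²)`. -/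
def ay (k : Type) [Field k] : AinfRing k := Ideal.Quotient.mk _ ((MvPowerSeries.X (1 : Fin 2) : MvPowerSeries (Fin 2) k))

/-- The ideal `I_n = (x, yⁿ)` of `R = k[[x,y]]/(x²)`. -/
def In (k : Type) [Field k] (n : ℕ) : Ideal (AinfRing k) := Ideal.span {ax k, ay k ^ n}


theorem ax_sq (k : Type) [Field k] : ax k * ax k = 0 := by
  unfold ax
  rw [← map_mul, ← pow_two]
  exact Ideal.Quotient.eq_zero_iff_mem.2 (Ideal.mem_span_singleton_self _)

theorem X0_dvd_of_mul (k : Type) [Field k] (n : ℕ) (b : MvPowerSeries (Fin 2) k)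
    (h : (MvPowerSeries.X (0 : Fin 2) : MvPowerSeries (Fin 2) k) ∣ b * MvPowerSeries.X 1 ^ n) :
    (MvPowerSeries.X (0 : Fin 2) : MvPowerSeries (Fin 2) k) ∣ b := by
  rw [MvPowerSeries.X_dvd_iff] at h ⊢
  intro m hm
  have := h (m + Finsupp.single 1 n) (by simp [hm])
  rwa [MvPowerSeries.X_pow_eq, MvPowerSeries.coeff_add_mul_monomial, mul_one] at this

theorem ax_syzygy (k : Type) [Field k] (n : ℕ) (a b : AinfRing k)
    (h : a * ax k + b * ay k ^ n = 0) :
    ∃ c d, a = -(c * ax k + d * ay k ^ n) ∧ b = d * ax k := by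
  obtain ⟨a, rfl⟩ := Ideal.Quotient.mk_surjective a
  obtain ⟨b, rfl⟩ := Ideal.Quotient.mk_surjective b
  unfold ax ay at *
  rw [← map_mul, ← map_pow, ← map_mul, ← map_add, Ideal.Quotient.eq_zero_iff_mem,
    Ideal.mem_span_singleton] at h
  obtain ⟨e, he⟩ := h
  obtain ⟨d, rfl⟩ := X0_dvd_of_mul k n b ⟨MvPowerSeries.X 0 * e - a, by linear_combination he⟩
  refine ⟨Ideal.Quotient.mk _ (-e), Ideal.Quotient.mk _ d, ?_, ?_⟩
  · rw [← map_pow, ← map_mul, ← map_mul, ← map_add, ← map_neg]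
    congr 1
    have h0 : (MvPowerSeries.X (0 : Fin 2) : MvPowerSeries (Fin 2) k) ≠ 0 := by
      intro h0
      have := congrArg (MvPowerSeries.coeff (Finsupp.single 0 1)) h0
      simp at this
    apply mul_left_cancel₀ h0
    linear_combination he
  · rw [← map_mul, mul_comm]

theorem In_ses (k : Type) [Field k] (n : ℕ) :
    ∃ (f : ↥(In k n) →ₗ[AinfRing k] (Fin 2 → AinfRing k))
       (g : (Fin 2 → AinfRing k) →ₗ[AinfRing k] ↥(In k n)),
       Function.Injective ⇑f ∧ Function.Surjective ⇑g ∧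
       LinearMap.range f = LinearMap.ker g := by
  let g : (Fin 2 → AinfRing k) →ₗ[AinfRing k] ↥(In k n) :=
    { toFun := fun a => ⟨a 0 * ax k + a 1 * ay k ^ n,
        Ideal.mem_span_pair.2 ⟨_, _, rfl⟩⟩
      map_add' := fun a b => by ext; simp; ring
      map_smul' := fun r a => by ext; simp; ring }
  let h : (Fin 2 → AinfRing k) →ₗ[AinfRing k] (Fin 2 → AinfRing k) :=
    { toFun := fun a => ![-(a 0 * ax k + a 1 * ay k ^ n), a 1 * ax k]
      map_add' := fun a b => by ext i; fin_cases i <;> simp <;> ring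
      map_smul' := fun r a => by ext i; fin_cases i <;> simp <;> ring }
  have hgz : ∀ a, g a = 0 ↔ a 0 * ax k + a 1 * ay k ^ n = 0 := fun a => by
    rw [Subtype.ext_iff]; rfl
  have hg : Function.Surjective g := by
    rintro ⟨i, hi⟩
    obtain ⟨a, b, hab⟩ := Ideal.mem_span_pair.1 hi
    exact ⟨![a, b], Subtype.ext (by simpa [g] using hab)⟩
  have hker : LinearMap.ker g = LinearMap.ker h := by
    ext a
    rw [LinearMap.mem_ker, LinearMap.mem_ker, hgz]
    constructor
    · intro ha
      obtain ⟨c, d, h1, h2⟩ := ax_syzygy k n _ _ ha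
      ext i
      fin_cases i
      · simp [h, ha, -neg_add_rev]
      · simp [h, h2, mul_assoc, ax_sq]
    · intro ha
      have := congrFun ha 0
      simpa [h, -neg_add_rev] using this
  have hrange : LinearMap.range h = LinearMap.ker g := by
    ext a
    rw [LinearMap.mem_ker, hgz]
    constructor
    · rintro ⟨b, rfl⟩
      simp only [h, LinearMap.coe_mk, AddHom.coe_mk, Matrix.cons_val_zero, Matrix.cons_val_one]
      linear_combination -(b 0) * ax_sq k
    · intro ha
      obtain ⟨c, d, h1, h2⟩ := ax_syzygy k n _ _ ha
      refine ⟨![c, d], ?_⟩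
      ext i
      fin_cases i
      · simp [h, h1]
      · simp [h, h2]
  let f := (LinearMap.ker g).liftQ h hker.le ∘ₗ (g.quotKerEquivOfSurjective hg).symm.toLinearMap
  refine ⟨f, g, ?_, hg, ?_⟩
  · have : Function.Injective ((LinearMap.ker g).liftQ h hker.le) := by
      rw [← LinearMap.ker_eq_bot]
      exact Submodule.ker_liftQ_eq_bot _ _ _ hker.ge
    exact this.comp (g.quotKerEquivOfSurjective hg).symm.injective
  · rw [LinearMap.range_comp, LinearEquiv.range, Submodule.map_top, Submodule.range_liftQ, hrange]

theorem In_finite (k : Type) [Field k] (n : ℕ) : Module.Finite (AinfRing k) ↥(In k n) :=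
  Module.Finite.iff_fg.2 (Submodule.fg_span (Set.toFinite _))

section DegHelpers

variable (k : Type) [Field k]

instance degV_dom : IsDomain (DegV k) :=
  inferInstanceAs (IsDomain (Localization.AtPrime (tIdeal k)))

instance degV_loc : IsLocalization.AtPrime (DegV k) (tIdeal k) :=
  inferInstanceAs (IsLocalization.AtPrime (Localization.AtPrime (tIdeal k)) (tIdeal k))

instance degK_loc : IsLocalization (Submonoid.powers (degT k)) (DegK k) :=
  inferInstanceAs (IsLocalization (Submonoid.powers (degT k))
    (Localization (Submonoid.powers (degT k))))

instance degK_tower : IsScalarTower k (DegV k) (DegK k) :=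
  inferInstanceAs (IsScalarTower k (DegV k) (Localization (Submonoid.powers (degT k))))

theorem mem_tCompl {p : Polynomial k} : p ∈ (tIdeal k).primeCompl ↔ p.coeff 0 ≠ 0 := by
  change ¬ (p ∈ tIdeal k) ↔ _
  rw [tIdeal, Ideal.mem_span_singleton, Polynomial.X_dvd_iff]

/-- First order Taylor expansion at `t = 0`. -/
def degTaylor : DegV k →+* DualNumber k :=
  IsLocalization.lift (M := (tIdeal k).primeCompl)
    (g := ((Polynomial.aeval (DualNumber.eps : DualNumber k) :
      Polynomial k →ₐ[k] DualNumber k) : Polynomial k →+* DualNumber k)) (by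
    rintro ⟨p, hp⟩
    rw [mem_tCompl] at hp
    rw [TrivSqZeroExt.isUnit_iff_isUnit_fst]
    have : TrivSqZeroExt.fst ((Polynomial.aeval (DualNumber.eps : DualNumber k)) p)
        = p.coeff 0 := by
      have h := Polynomial.aeval_algHom_apply (TrivSqZeroExt.fstHom k k k)
        (DualNumber.eps : DualNumber k) p
      simp only [TrivSqZeroExt.fstHom_apply, DualNumber.fst_eps] at h
      rw [← h, Polynomial.coeff_zero_eq_aeval_zero]
    simpa [this] using hp)

theorem degTaylor_alg (p : Polynomial k) :
    degTaylor k (algebraMap _ _ p) = Polynomial.aeval (DualNumber.eps : DualNumber k) p :=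
  IsLocalization.lift_eq _ _

theorem degTaylor_k (c : k) : degTaylor k (algebraMap k _ c) = algebraMap k _ c := by
  rw [IsScalarTower.algebraMap_apply k (Polynomial k) (DegV k), degTaylor_alg]
  simp

theorem degTaylor_t : degTaylor k (degT k) = DualNumber.eps := by
  rw [degT, degTaylor_alg]; simp

/-- Taylor expansion as an algebra map. -/
def degTaylorA : DegV k →ₐ[k] DualNumber k :=
  { degTaylor k with commutes' := degTaylor_k k }

/-- Value at zero. -/
def ev0 : DegV k →ₗ[k] k := (TrivSqZeroExt.fstHom k k k).toLinearMap ∘ₗ (degTaylorA k).toLinearMap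

/-- Derivative at zero. -/
def ev1 : DegV k →ₗ[k] k := TrivSqZeroExt.sndHom k k ∘ₗ (degTaylorA k).toLinearMap

theorem ev0_one : ev0 k 1 = 1 := by simp [ev0]
theorem ev1_one : ev1 k 1 = 0 := by simp [ev1]
theorem ev0_mul (v w : DegV k) : ev0 k (v * w) = ev0 k v * ev0 k w := by simp [ev0]
theorem ev1_mul (v w : DegV k) : ev1 k (v * w) = ev0 k v * ev1 k w + ev1 k v * ev0 k w := by
  simp [ev0, ev1]
theorem ev0_t : ev0 k (degT k) = 0 := by
  change TrivSqZeroExt.fst (degTaylor k (degT k)) = 0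
  rw [degTaylor_t]; simp
theorem ev1_t : ev1 k (degT k) = 1 := by
  change TrivSqZeroExt.snd (degTaylor k (degT k)) = 1
  rw [degTaylor_t]; simp

theorem degV_decomp (v : DegV k) : ∃ w, v = ev0 k v • 1 + degT k * w := by
  obtain ⟨⟨p, s⟩, h⟩ := IsLocalization.surj (tIdeal k).primeCompl v
  have hp : ev0 k (algebraMap _ _ p) = p.coeff 0 := by
    obtain ⟨q, hq⟩ : Polynomial.X ∣ p - Polynomial.C (p.coeff 0) := by
      rw [Polynomial.X_dvd_iff]; simp
    have : algebraMap (Polynomial k) (DegV k) p = p.coeff 0 • 1 + degT k * algebraMap _ _ q := by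
      rw [degT, ← map_mul, ← hq, Algebra.smul_def,
        IsScalarTower.algebraMap_apply k (Polynomial k) (DegV k)]
      simp
    rw [this, map_add, ev0_mul, ev0_t, map_smul, ev0_one]; simp
  have hs : ev0 k (algebraMap _ _ s.1) = s.1.coeff 0 := by
    obtain ⟨q, hq⟩ : Polynomial.X ∣ s.1 - Polynomial.C (s.1.coeff 0) := by
      rw [Polynomial.X_dvd_iff]; simp
    have : algebraMap (Polynomial k) (DegV k) s.1
        = s.1.coeff 0 • 1 + degT k * algebraMap _ _ q := by
      rw [degT, ← map_mul, ← hq, Algebra.smul_def,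
        IsScalarTower.algebraMap_apply k (Polynomial k) (DegV k)]
      simp
    rw [this, map_add, ev0_mul, ev0_t, map_smul, ev0_one]; simp
  simp only at h
  have h0 := congrArg (ev0 k) h
  rw [ev0_mul, hp, hs] at h0
  obtain ⟨q, hq⟩ : Polynomial.X ∣ p - Polynomial.C (ev0 k v) * s.1 := by
    rw [Polynomial.X_dvd_iff]; simp [← h0]
  have hu := IsLocalization.map_units (DegV k) s
  obtain ⟨u, hu⟩ := hu
  refine ⟨algebraMap _ _ q * ↑u⁻¹, ?_⟩
  have hq' := congrArg (algebraMap (Polynomial k) (DegV k)) hq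
  rw [map_sub, map_mul, map_mul, ← h] at hq'
  change _ = degT k * _ at hq'
  have hC : algebraMap (Polynomial k) (DegV k) (Polynomial.C (ev0 k v)) = ev0 k v • 1 := by
    rw [Algebra.smul_def, IsScalarTower.algebraMap_apply k (Polynomial k) (DegV k)]
    simp
  rw [hC, ← hu] at hq'
  have h1 := u.mul_inv
  linear_combination ↑u⁻¹ * hq' + (ev0 k v • 1 - v) * h1

theorem degT_ne : degT k ≠ 0 := fun h => by
  have := ev1_t k
  rw [h] at this; simp at this

theorem degVK_inj : Function.Injective (algebraMap (DegV k) (DegK k)) :=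
  IsLocalization.injective _ (M := Submonoid.powers (degT k))
    (powers_le_nonZeroDivisors_of_noZeroDivisors (degT_ne k))

end DegHelpers

section DegGeneral

variable (k : Type) [Field k] (R : Type) [CommRing R] [Algebra k R]
variable (M : Type) [AddCommGroup M] [Module R M] [Module k M] [IsScalarTower k R M]

/-- `M ⊗ V`. -/
def DMV : Type := M ⊗[k] DegV k

instance : AddCommGroup (DMV k M) := inferInstanceAs (AddCommGroup (M ⊗[k] DegV k))
instance : Module k (DMV k M) := inferInstanceAs (Module k (M ⊗[k] DegV k))

/-- The action of `R ⊗ V` on `M ⊗ V`. -/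
def dmvAct : R ⊗[k] DegV k →ₐ[k] Module.End k (M ⊗[k] DegV k) :=
  (Module.endTensorEndAlgHom (R := k) (S := k) (A := k) (M := M) (N := DegV k)).comp
    (Algebra.TensorProduct.map (Algebra.lsmul k k M) (Algebra.lmul k (DegV k)))

instance dmvModule : Module (R ⊗[k] DegV k) (DMV k M) :=
  Module.compHom (M ⊗[k] DegV k) (dmvAct k R M).toRingHom

/-- Pure tensors. -/
def dtm (m : M) (v : DegV k) : DMV k M := m ⊗ₜ[k] v

theorem dmv_smul (r : R) (v : DegV k) (m : M) (w : DegV k) :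
    (r ⊗ₜ[k] v : R ⊗[k] DegV k) • dtm k M m w = dtm k M (r • m) (v * w) := by
  change dmvAct k R M (r ⊗ₜ[k] v) (m ⊗ₜ[k] w) = _
  simp [dmvAct, Module.endTensorEndAlgHom_apply, dtm]

theorem dmv_ind {P : DMV k M → Prop} (h0 : P 0) (ht : ∀ m v, P (dtm k M m v))
    (ha : ∀ a b, P a → P b → P (a + b)) (q : DMV k M) : P q :=
  TensorProduct.induction_on (motive := P) q h0 ht ha

/-- Reduction modulo `t`. -/
def rho0 : DMV k M →ₗ[k] M := (TensorProduct.rid k M).toLinearMap ∘ₗ LinearMap.lTensor M (ev0 k)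

/-- First order coefficient. -/
def rho1 : DMV k M →ₗ[k] M := (TensorProduct.rid k M).toLinearMap ∘ₗ LinearMap.lTensor M (ev1 k)

theorem rho0_tm (m : M) (v : DegV k) : rho0 k M (dtm k M m v) = ev0 k v • m := by
  change TensorProduct.rid k M (LinearMap.lTensor M (ev0 k) (m ⊗ₜ v)) = _
  simp

theorem rho1_tm (m : M) (v : DegV k) : rho1 k M (dtm k M m v) = ev1 k v • m := by
  change TensorProduct.rid k M (LinearMap.lTensor M (ev1 k) (m ⊗ₜ v)) = _
  simp

theorem rho0_smul (r : R) (v : DegV k) (q : DMV k M) :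
    rho0 k M ((r ⊗ₜ[k] v : R ⊗[k] DegV k) • q) = r • ev0 k v • rho0 k M q := by
  induction q using dmv_ind with
  | h0 => simp
  | ht m w =>
    rw [dmv_smul, rho0_tm, rho0_tm, ev0_mul, mul_smul, smul_comm r, smul_comm r]
  | ha a b h1 h2 => simp only [smul_add, map_add, h1, h2]

theorem rho1_smul (r : R) (v : DegV k) (q : DMV k M) :
    rho1 k M ((r ⊗ₜ[k] v : R ⊗[k] DegV k) • q)
      = r • (ev0 k v • rho1 k M q + ev1 k v • rho0 k M q) := by
  induction q using dmv_ind with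
  | h0 => simp
  | ht m w =>
    rw [dmv_smul, rho1_tm, rho1_tm, rho0_tm, ev1_mul, ← mul_smul, ← mul_smul, ← add_smul,
      smul_comm r]
  | ha a b h1 h2 =>
    simp only [smul_add, map_add, h1, h2]; abel

/-- multiplication by `v` -/
theorem dmv_one_smul (v : DegV k) (q : DMV k M) :
    ((1 : R) ⊗ₜ[k] v : R ⊗[k] DegV k) • q = LinearMap.lTensor M (LinearMap.mulLeft k v) q := by
  induction q using dmv_ind with
  | h0 => rw [smul_zero]; exact (map_zero _).symm
  | ht m w => rw [dmv_smul, one_smul]; rfl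
  | ha a b h1 h2 => rw [smul_add, h1, h2]; exact (map_add _ _ _).symm

theorem dmv_decomp (q : DMV k M) :
    ∃ q', q = dtm k M (rho0 k M q) 1 + ((1 : R) ⊗ₜ[k] degT k : R ⊗[k] DegV k) • q' := by
  induction q using dmv_ind with
  | h0 => exact ⟨0, by simp [dtm]; rfl⟩
  | ht m v =>
    obtain ⟨w, hw⟩ := degV_decomp k v
    refine ⟨dtm k M m w, ?_⟩
    rw [dmv_smul, rho0_tm, one_smul]
    conv_lhs => rw [hw]
    change m ⊗ₜ[k] _ = (_ ⊗ₜ[k] _ + _ ⊗ₜ[k] _ : M ⊗[k] DegV k)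
    rw [TensorProduct.tmul_add, TensorProduct.smul_tmul]
    rfl
  | ha a b h1 h2 =>
    obtain ⟨a', ha⟩ := h1
    obtain ⟨b', hb⟩ := h2
    refine ⟨a' + b', ?_⟩
    have : dtm k M (rho0 k M (a + b)) 1 = dtm k M (rho0 k M a) 1 + dtm k M (rho0 k M b) 1 := by
      rw [map_add]; exact TensorProduct.add_tmul _ _ _
    rw [this, smul_add]
    conv_lhs => rw [ha, hb]
    abel

variable {M} {N : Type} [AddCommGroup N] [Module R N] (g : M →ₗ[R] N)

/-- The family `Q`. -/
def DQ : Submodule (R ⊗[k] DegV k) (DMV k M) where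
  carrier := {q | g (rho0 k M q) = 0}
  add_mem' := by
    intro a b ha hb
    simp only [Set.mem_ofPred_eq] at *
    rw [map_add, map_add, ha, hb, add_zero]
  zero_mem' := by simp
  smul_mem' := by
    intro s q hq
    simp only [Set.mem_ofPred_eq] at *
    induction s with
    | zero => simp
    | tmul r v =>
      rw [rho0_smul, map_smul, ← algebraMap_smul R (ev0 k v), map_smul, hq]; simp
    | add a b ha hb => rw [add_smul, map_add, map_add, ha, hb, add_zero]

theorem mem_DQ (q : DMV k M) : q ∈ DQ k R g ↔ g (rho0 k M q) = 0 := Iff.rfl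

theorem t_smul_mem (q : DMV k M) :
    ((1 : R) ⊗ₜ[k] degT k : R ⊗[k] DegV k) • q ∈ DQ k R g := by
  rw [mem_DQ, rho0_smul, ev0_t]; simp

theorem DQ_finite [Module.Finite R M] (hk : (LinearMap.ker g).FG) :
    Module.Finite (R ⊗[k] DegV k) (DQ k R g) := by
  obtain ⟨A, hA⟩ := hk
  obtain ⟨B, hB⟩ := (inferInstance : Module.Finite R M).fg_top
  rw [Module.Finite.iff_fg]
  have hadd : ∀ (m m' : M) v, dtm k M (m + m') v = dtm k M m v + dtm k M m' v :=
    fun m m' v => TensorProduct.add_tmul _ _ _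
  have hzero : ∀ v, dtm k M (0 : M) v = 0 := fun v => TensorProduct.zero_tmul _ _
  set T : Set (DMV k M) := (fun m => dtm k M m 1) '' A ∪ (fun m => dtm k M m (degT k)) '' B with hT
  have hTf : T.Finite := (A.finite_toSet.image _).union (B.finite_toSet.image _)
  have : DQ k R g = Submodule.span _ T := by
    apply le_antisymm
    · intro q hq
      rw [mem_DQ, ← LinearMap.mem_ker, ← hA] at hq
      have h1 : ∀ m ∈ Submodule.span R (A : Set M),
          dtm k M m 1 ∈ Submodule.span (R ⊗[k] DegV k) T := by
        intro m hm
        induction hm using Submodule.span_induction with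
        | mem x hx => exact Submodule.subset_span (Or.inl ⟨x, hx, rfl⟩)
        | zero => rw [hzero]; exact zero_mem _
        | add x y _ _ hx hy => rw [hadd]; exact add_mem hx hy
        | smul r x _ hx =>
          have := Submodule.smul_mem _ (r ⊗ₜ[k] (1 : DegV k) : R ⊗[k] DegV k) hx
          rwa [dmv_smul, mul_one] at this
      have h2 : ∀ m : M, dtm k M m (degT k) ∈ Submodule.span (R ⊗[k] DegV k) T := by
        intro m
        have hm : m ∈ Submodule.span R (B : Set M) := hB ▸ Submodule.mem_top
        induction hm using Submodule.span_induction with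
        | mem x hx => exact Submodule.subset_span (Or.inr ⟨x, hx, rfl⟩)
        | zero => rw [hzero]; exact zero_mem _
        | add x y _ _ hx hy => rw [hadd]; exact add_mem hx hy
        | smul r x _ hx =>
          have := Submodule.smul_mem _ (r ⊗ₜ[k] (1 : DegV k) : R ⊗[k] DegV k) hx
          rwa [dmv_smul, one_mul] at this
      have h3 : ∀ q : DMV k M, ((1 : R) ⊗ₜ[k] degT k : R ⊗[k] DegV k) • q ∈
          Submodule.span (R ⊗[k] DegV k) T := by
        intro q
        induction q using dmv_ind with
        | h0 => simp
        | ht m v =>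
          have := Submodule.smul_mem _ ((1 : R) ⊗ₜ[k] v : R ⊗[k] DegV k) (h2 m)
          rw [dmv_smul] at this
          rwa [dmv_smul, mul_comm]
        | ha a b h1 h2 => rw [smul_add]; exact add_mem h1 h2
      obtain ⟨q', hq'⟩ := dmv_decomp k R M q
      rw [hq']
      exact add_mem (h1 _ hq) (h3 _)
    · rw [Submodule.span_le]
      rintro _ (⟨m, hm, rfl⟩ | ⟨m, hm, rfl⟩)
      · have : m ∈ LinearMap.ker g := hA ▸ Submodule.subset_span hm
        change g (rho0 k M (dtm k M m 1)) = 0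
        rw [rho0_tm, ev0_one, one_smul]; exact this
      · change g (rho0 k M (dtm k M m (degT k))) = 0
        rw [rho0_tm, ev0_t, zero_smul, map_zero]
  rw [this]
  exact Submodule.fg_span hTf

theorem DQ_flat : letI := vRestrict k R (DQ k R g); Module.Flat (DegV k) (DQ k R g) := by
  letI := vRestrict k R (DQ k R g)
  haveI : IsDedekindDomain (DegV k) :=
    IsLocalization.AtPrime.isDedekindDomain (Polynomial k) (tIdeal k) (DegV k)
  change Module.Flat (DegV k) (DQ k R g)
  rw [IsDedekindDomain.flat_iff_torsion_eq_bot, eq_bot_iff]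
  rintro q ⟨⟨v, hv⟩, h⟩
  have h' : ((1 : R) ⊗ₜ[k] v : R ⊗[k] DegV k) • q.1 = 0 := congrArg Subtype.val h
  rw [dmv_one_smul] at h'
  have hi : Function.Injective (LinearMap.lTensor M (LinearMap.mulLeft k v)) := by
    apply Module.Flat.lTensor_preserves_injective_linearMap
    intro a b hab
    exact mul_left_cancel₀ (nonZeroDivisors.ne_zero hv) hab
  rw [Submodule.mem_bot]
  apply Subtype.ext
  exact hi (h'.trans (map_zero _).symm)

theorem DQ_quot {N' : Type} [AddCommGroup N'] [Module R N'] (f : N' →ₗ[R] M)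
    (hf : Function.Injective f) (hg : Function.Surjective g)
    (hfg : LinearMap.range f = LinearMap.ker g) :
    letI := rRestrict k R (DQ k R g ⧸ LinearMap.range (tSmul k R (DQ k R g)))
    Nonempty ((DQ k R g ⧸ LinearMap.range (tSmul k R (DQ k R g))) ≃ₗ[R] (N' × N)) := by
  letI := rRestrict k R (DQ k R g ⧸ LinearMap.range (tSmul k R (DQ k R g)))
  change Nonempty ((DQ k R g ⧸ LinearMap.range (tSmul k R (DQ k R g))) ≃ₗ[R] (N' × N))
  have hex : ∀ q : DQ k R g, ∃ n', f n' = rho0 k M q.1 := fun q => by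
    have : rho0 k M q.1 ∈ LinearMap.ker g := q.2
    rwa [← hfg] at this
  choose F hF using hex
  let φ : DQ k R g →+ N' × N :=
    { toFun := fun q => (F q, g (rho1 k M q.1))
      map_zero' := by
        refine Prod.ext (hf ?_) ?_
        · simp [hF]
        · simp
      map_add' := fun a b => by
        refine Prod.ext (hf ?_) ?_
        · simp [hF]
        · simp }
  have hφt : ∀ q, φ (tSmul k R (DQ k R g) q) = 0 := by
    intro q
    refine Prod.ext (hf ?_) ?_
    · change f (F _) = f 0
      rw [hF, map_zero]
      change rho0 k M (((1 : R) ⊗ₜ[k] degT k : R ⊗[k] DegV k) • q.1) = 0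
      rw [rho0_smul, ev0_t]; simp
    · change g (rho1 k M (((1 : R) ⊗ₜ[k] degT k : R ⊗[k] DegV k) • q.1)) = 0
      rw [rho1_smul, ev0_t, ev1_t]; simpa using (mem_DQ k R g q.1).1 q.2
  have hφr : ∀ (r : R) q, φ ((r ⊗ₜ[k] (1 : DegV k) : R ⊗[k] DegV k) • q) = r • φ q := by
    intro r q
    refine Prod.ext (hf ?_) ?_
    · change f (F _) = f (r • F _)
      rw [hF, map_smul, hF]
      change rho0 k M ((r ⊗ₜ[k] (1 : DegV k) : R ⊗[k] DegV k) • q.1) = _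
      rw [rho0_smul, ev0_one, one_smul]
    · change g (rho1 k M ((r ⊗ₜ[k] (1 : DegV k) : R ⊗[k] DegV k) • q.1)) = r • g _
      rw [rho1_smul, ev0_one, ev1_one]; simp
  let ψ : (DQ k R g ⧸ LinearMap.range (tSmul k R (DQ k R g))) →+ N' × N :=
    QuotientAddGroup.lift (LinearMap.range (tSmul k R (DQ k R g))).toAddSubgroup φ (by
      rintro _ ⟨q, rfl⟩
      exact hφt q)
  have hψ : ∀ q : DQ k R g, ψ (Submodule.Quotient.mk q) = φ q := fun q => rfl
  let Ψ : (DQ k R g ⧸ LinearMap.range (tSmul k R (DQ k R g))) →ₗ[R] N' × N :=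
    { toFun := ψ
      map_add' := map_add ψ
      map_smul' := by
        intro r q
        obtain ⟨q, rfl⟩ := Submodule.Quotient.mk_surjective _ q
        exact hφr r q }
  refine ⟨LinearEquiv.ofBijective Ψ ⟨?_, ?_⟩⟩
  · rw [injective_iff_map_eq_zero]
    intro q hq
    obtain ⟨q, rfl⟩ := Submodule.Quotient.mk_surjective _ q
    have h0 : φ q = 0 := hq
    have h1 : F q = 0 := congrArg Prod.fst h0
    have h2 : g (rho1 k M q.1) = 0 := congrArg Prod.snd h0
    have h3 : rho0 k M q.1 = 0 := by rw [← hF, h1, map_zero]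
    obtain ⟨q', hq'⟩ := dmv_decomp k R M q.1
    have h4 : dtm k M (0 : M) 1 = 0 := TensorProduct.zero_tmul _ _
    rw [h3, h4, zero_add] at hq'
    have h5 : rho1 k M q.1 = rho0 k M q' := by
      rw [hq', rho1_smul, ev0_t, ev1_t]; simp
    rw [Submodule.Quotient.mk_eq_zero]
    exact ⟨⟨q', by rw [mem_DQ, ← h5, h2]⟩, Subtype.ext hq'.symm⟩
  · rintro ⟨n', n⟩
    obtain ⟨m, rfl⟩ := hg n
    have hn' : g (f n') = 0 := by
      have : f n' ∈ LinearMap.range f := ⟨_, rfl⟩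
      rwa [hfg] at this
    have e0 : rho0 k M (dtm k M (f n') 1
        + ((1 : R) ⊗ₜ[k] degT k : R ⊗[k] DegV k) • dtm k M m 1) = f n' := by
      rw [map_add, rho0_smul, ev0_t, rho0_tm, ev0_one]; simp
    have e1 : rho1 k M (dtm k M (f n') 1
        + ((1 : R) ⊗ₜ[k] degT k : R ⊗[k] DegV k) • dtm k M m 1) = m := by
      rw [map_add, rho1_smul, ev0_t, rho1_tm, ev1_one, ev1_t, rho0_tm, ev0_one]; simp
    refine ⟨Submodule.Quotient.mk ⟨_, by rw [mem_DQ, e0, hn']⟩, ?_⟩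
    refine Prod.ext (hf ?_) ?_
    · change f (F _) = _
      rw [hF]; exact e0
    · change g (rho1 k M _) = _
      rw [e1]

/-- Action of `K` on `M ⊗ K`. -/
def kAct (M : Type) [AddCommGroup M] [Module k M] (c : DegK k) : M ⊗[k] DegK k →ₗ[k] M ⊗[k] DegK k :=
  LinearMap.lTensor M (LinearMap.mulLeft k c)

theorem kAct_mul (c d : DegK k) (x : M ⊗[k] DegK k) :
    kAct k M (c * d) x = kAct k M c (kAct k M d x) := by
  unfold kAct
  rw [LinearMap.mulLeft_mul, LinearMap.lTensor_comp]; rfl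

theorem kAct_one (x : M ⊗[k] DegK k) : kAct k M 1 x = x := by
  unfold kAct
  rw [LinearMap.mulLeft_one, LinearMap.lTensor_id]; rfl

/-- `V → End (M ⊗ K)`. -/
def vActK (M : Type) [AddCommGroup M] [Module k M] : DegV k →+* Module.End k (M ⊗[k] DegK k) where
  toFun v := kAct k M (algebraMap _ _ v)
  map_one' := by ext1; rw [map_one]; ext; simp [kAct]
  map_mul' a b := by rw [map_mul]; exact LinearMap.ext fun x => kAct_mul k _ _ x
  map_zero' := by ext; simp [kAct]
  map_add' a b := by ext; simp [kAct, add_mul, TensorProduct.tmul_add]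

theorem kAct_surj (x : M ⊗[k] DegK k) : ∃ (n : ℕ) (y : M ⊗[k] DegV k),
    kAct k M (algebraMap _ _ (degT k ^ n)) x
      = LinearMap.lTensor M (IsScalarTower.toAlgHom k (DegV k) (DegK k)).toLinearMap y := by
  have key : ∀ (v : DegV k) (y : M ⊗[k] DegV k), kAct k M (algebraMap _ _ v)
      (LinearMap.lTensor M (IsScalarTower.toAlgHom k (DegV k) (DegK k)).toLinearMap y)
      = LinearMap.lTensor M (IsScalarTower.toAlgHom k (DegV k) (DegK k)).toLinearMap
        (LinearMap.lTensor M (LinearMap.mulLeft k v) y) := by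
    intro v y
    induction y with
    | zero => simp
    | tmul m w => simp [kAct]
    | add a b ha hb => simp only [map_add, ha, hb]
  induction x with
  | zero => exact ⟨0, 0, by simp⟩
  | tmul m c =>
    obtain ⟨⟨v, ⟨_, n, rfl⟩⟩, h⟩ := IsLocalization.surj (Submonoid.powers (degT k)) c
    refine ⟨n, m ⊗ₜ v, ?_⟩
    simp only at h
    simp [kAct, ← h, mul_comm]
  | add a b ha hb =>
    obtain ⟨n, y, hy⟩ := ha
    obtain ⟨n', y', hy'⟩ := hb
    refine ⟨n + n', LinearMap.lTensor M (LinearMap.mulLeft k (degT k ^ n')) y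
      + LinearMap.lTensor M (LinearMap.mulLeft k (degT k ^ n)) y', ?_⟩
    rw [map_add, map_add, ← key, ← key, ← hy, ← hy', ← kAct_mul, ← kAct_mul, ← map_mul, ← map_mul,
      ← pow_add, ← pow_add, add_comm n']

theorem kAct_inv (n : ℕ) : ∃ d : DegK k, d * algebraMap _ _ (degT k ^ n) = 1 := by
  have := IsLocalization.map_units (DegK k) (⟨degT k ^ n, n, rfl⟩ : Submonoid.powers (degT k))
  obtain ⟨d, hd⟩ := this.exists_left_inv
  exact ⟨d, hd⟩

end DegGeneral

section DegFinal

variable (k : Type) [Field k] (R : Type) [CommRing R] [Algebra k R]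
variable {M : Type} [AddCommGroup M] [Module R M] [Module k M] [IsScalarTower k R M]
variable {N : Type} [AddCommGroup N] [Module R N] (g : M →ₗ[R] N)

/-- The inclusion `M ⊗ V → M ⊗ K`. -/
def vkMap (M : Type) [AddCommGroup M] [Module k M] : M ⊗[k] DegV k →ₗ[k] M ⊗[k] DegK k :=
  LinearMap.lTensor M (IsScalarTower.toAlgHom k (DegV k) (DegK k)).toLinearMap

theorem vkMap_inj : Function.Injective (vkMap k M) :=
  Module.Flat.lTensor_preserves_injective_linearMap _ (degVK_inj k)

theorem vkMap_smul (v : DegV k) (q : DMV k M) :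
    vkMap k M (((1 : R) ⊗ₜ[k] v : R ⊗[k] DegV k) • q)
      = kAct k M (algebraMap _ _ v) (vkMap k M q) := by
  induction q using dmv_ind with
  | h0 => rw [smul_zero]; simp [show vkMap k M (0 : DMV k M) = 0 from map_zero _]
  | ht m w =>
    rw [dmv_smul]
    change vkMap k M (_ ⊗ₜ _) = kAct k M _ (vkMap k M (_ ⊗ₜ _))
    simp [vkMap, kAct]
  | ha a b h1 h2 =>
    rw [smul_add]
    have hadd : ∀ x y : DMV k M, vkMap k M (x + y) = vkMap k M x + vkMap k M y :=
      fun x y => map_add _ _ _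
    rw [hadd, hadd, h1, h2, map_add]

/-- The R-action on `M ⊗ K`. -/
def rActT (h : M →ₗ[k] M) : M ⊗[k] DegK k →ₗ[k] M ⊗[k] DegK k := LinearMap.rTensor (DegK k) h

theorem vkMap_rsmul (r : R) (h : M →ₗ[k] M) (hr : ∀ m, h m = r • m) (q : DMV k M) :
    vkMap k M ((r ⊗ₜ[k] (1 : DegV k) : R ⊗[k] DegV k) • q)
      = LinearMap.rTensor (DegK k) h (vkMap k M q) := by
  induction q using dmv_ind with
  | h0 => rw [smul_zero]; simp [show vkMap k M (0 : DMV k M) = 0 from map_zero _]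
  | ht m w =>
    rw [dmv_smul]
    change vkMap k M (_ ⊗ₜ _) = LinearMap.rTensor _ h (vkMap k M (_ ⊗ₜ _))
    simp [vkMap, hr]
  | ha a b h1 h2 =>
    rw [smul_add]
    have hadd : ∀ x y : DMV k M, vkMap k M (x + y) = vkMap k M x + vkMap k M y :=
      fun x y => map_add _ _ _
    rw [hadd, hadd, h1, h2, map_add]

theorem kAct_comm (c : DegK k) (h : M →ₗ[k] M) (x : M ⊗[k] DegK k) :
    kAct k M c (LinearMap.rTensor (DegK k) h x) = LinearMap.rTensor (DegK k) h (kAct k M c x) := by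
  induction x with
  | zero => simp
  | tmul m w => simp [kAct]
  | add a b ha hb => simp only [map_add, ha, hb]

theorem DQ_loc (act : R → (M →ₗ[k] M)) (hact : ∀ r m, act r m = r • m) :
    letI := vRestrict k R (DQ k R g)
    ∃ f : LocalizedModule (Submonoid.powers (degT k)) (DQ k R g) ≃+ (M ⊗[k] DegK k),
       (∀ (c : DegK k) (x : LocalizedModule (Submonoid.powers (degT k)) (DQ k R g)),
          f (c • x) = LinearMap.lTensor M (LinearMap.mulLeft k c) (f x)) ∧
       (∀ (r : R) (x : LocalizedModule (Submonoid.powers (degT k)) (DQ k R g)),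
          f (LocalizedModule.map (Submonoid.powers (degT k)) (rAct k R (DQ k R g) r) x)
            = LinearMap.rTensor (DegK k) (act r) (f x)) := by
  letI := vRestrict k R (DQ k R g)
  letI : Module (DegV k) (M ⊗[k] DegK k) := Module.compHom (M ⊗[k] DegK k) (vActK k M)
  have hsm : ∀ (v : DegV k) (x : M ⊗[k] DegK k), v • x = kAct k M (algebraMap _ _ v) x :=
    fun v x => rfl
  let j : DQ k R g →ₗ[DegV k] M ⊗[k] DegK k :=
    { toFun := fun q => vkMap k M q.1
      map_add' := fun a b => map_add (vkMap k M) a.1 b.1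
      map_smul' := fun v q => vkMap_smul k R v q.1 }
  have hj : ∀ q, j q = vkMap k M q.1 := fun q => rfl
  haveI : IsLocalizedModule (Submonoid.powers (degT k)) j :=
    { map_units := by
        rintro ⟨_, n, rfl⟩
        obtain ⟨d, hd⟩ := kAct_inv k n
        rw [Module.End.isUnit_iff]
        constructor
        · intro x y hxy
          have h : kAct k M (algebraMap _ _ (degT k ^ n)) x
            = kAct k M (algebraMap _ _ (degT k ^ n)) y := hxy
          have h2 := congrArg (kAct k M d) h
          rwa [← kAct_mul, ← kAct_mul, hd, kAct_one, kAct_one] at h2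
        · intro x
          refine ⟨kAct k M d x, ?_⟩
          change kAct k M (algebraMap _ _ (degT k ^ n)) (kAct k M d x) = x
          rw [← kAct_mul, mul_comm, hd, kAct_one]
      surj := by
        intro x
        obtain ⟨n, y', hy⟩ := kAct_surj k x
        let y : DMV k M := y'
        refine ⟨(⟨((1 : R) ⊗ₜ[k] degT k : R ⊗[k] DegV k) • y, t_smul_mem k R g y⟩,
          ⟨degT k ^ (n + 1), n + 1, rfl⟩), ?_⟩
        change kAct k M (algebraMap _ _ (degT k ^ (n + 1))) x = vkMap k M _
        rw [vkMap_smul, pow_succ', map_mul, kAct_mul, hy]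
        rfl
      exists_of_eq := by
        intro a b hab
        exact ⟨1, by rw [Subtype.ext (vkMap_inj k hab)]⟩ }
  let f := IsLocalizedModule.iso (Submonoid.powers (degT k)) j
  have hinj : ∀ s : Submonoid.powers (degT k), ∀ x y : M ⊗[k] DegK k,
      kAct k M (algebraMap _ _ s.1) x = kAct k M (algebraMap _ _ s.1) y → x = y := by
    rintro ⟨_, n, rfl⟩ x y h
    obtain ⟨d, hd⟩ := kAct_inv k n
    have h2 := congrArg (kAct k M d) h
    simp only at h2
    rwa [← kAct_mul, ← kAct_mul, hd, kAct_one, kAct_one] at h2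
  have hf : ∀ (q : DQ k R g) (s : Submonoid.powers (degT k)),
      kAct k M (algebraMap _ _ s.1) (f (LocalizedModule.mk q s)) = vkMap k M q.1 := by
    intro q s
    rw [← hsm, ← map_smul, LocalizedModule.smul'_mk]
    have : LocalizedModule.mk (s.1 • q) s = LocalizedModule.mk q 1 := by
      exact LocalizedModule.mk_cancel s q
    rw [this, ← hj, ← LocalizedModule.mkLinearMap_apply]
    exact IsLocalizedModule.iso_mk_one _ j q
  have hc : ∀ c : DegK k, ∃ (v : DegV k) (s' : Submonoid.powers (degT k)),
      algebraMap (DegV k) (DegK k) s'.1 * c = algebraMap (DegV k) (DegK k) v ∧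
      ∀ (q : DQ k R g) (s : Submonoid.powers (degT k)),
        c • LocalizedModule.mk q s = LocalizedModule.mk (v • q) (s' * s) := by
    intro c
    obtain ⟨⟨v, s'⟩, hc⟩ : ∃ y : DegV k × Submonoid.powers (degT k),
        (Localization.mk y.1 y.2 : Localization _) = c :=
      Localization.induction_on (p := fun c => ∃ y : DegV k × Submonoid.powers (degT k),
        Localization.mk y.1 y.2 = c) c (fun y => ⟨y, rfl⟩)
    refine ⟨v, s', ?_, ?_⟩
    · have h1 := IsLocalization.mk'_spec' (DegK k) v s'
      have h2 : IsLocalization.mk' (DegK k) v s' = c :=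
        (Localization.mk_eq_mk'_apply v s').symm.trans hc
      rwa [h2] at h1
    · intro q s
      subst hc
      exact LocalizedModule.mk_smul_mk _ _ _ _
  refine ⟨f.toAddEquiv, ?_, ?_⟩
  · intro c x
    change f (c • x) = kAct k M c (f x)
    induction x using LocalizedModule.induction_on with
    | h q s =>
    obtain ⟨v, s', e2, e⟩ := hc c
    apply hinj (s' * s)
    rw [e, hf]
    have e3 : vkMap k M (v • q).1 = kAct k M (algebraMap _ _ v) (vkMap k M q.1) :=
      vkMap_smul k R v q.1
    rw [e3, ← hf q s, ← kAct_mul, ← kAct_mul]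
    congr 2
    rw [← e2, Submonoid.coe_mul, map_mul]
    ring
  · intro r x
    change f (_) = LinearMap.rTensor (DegK k) (act r) (f x)
    induction x using LocalizedModule.induction_on with
    | h q s =>
    rw [LocalizedModule.map_mk]
    apply hinj s
    rw [hf, kAct_comm, hf]
    exact vkMap_rsmul k R r (act r) (hact r) q.1

end DegFinal

theorem degenerates_of_ses (k : Type) [Field k] (R : Type) [CommRing R] [Algebra k R]
    (M N' N P : Type) [AddCommGroup M] [Module R M] [AddCommGroup N] [Module R N]
    [AddCommGroup N'] [Module R N'] [AddCommGroup P] [Module R P]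
    [Module.Finite R M] [Module.Finite R N']
    (f : N' →ₗ[R] M) (g : M →ₗ[R] N)
    (hf : Function.Injective f) (hg : Function.Surjective g)
    (hfg : LinearMap.range f = LinearMap.ker g) (e : (N' × N) ≃ₗ[R] P) :
    Degenerates k R M P := by
  letI : Module k M := Module.compHom M (algebraMap k R)
  haveI : IsScalarTower k R M := ⟨fun c r m => by
    rw [Algebra.smul_def, mul_smul]; rfl⟩
  refine ⟨DQ k R g, inferInstance, inferInstance, ?_, DQ_flat k R g, ?_, ?_⟩
  · apply DQ_finite
    rw [← hfg]
    exact Module.Finite.iff_fg.1 (Module.Finite.range f)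
  · obtain ⟨a⟩ := DQ_quot k R g f hf hg hfg
    letI := rRestrict k R (DQ k R g ⧸ LinearMap.range (tSmul k R (DQ k R g)))
    exact ⟨a.trans e⟩
  · exact DQ_loc k R g (rActK k R M) (fun r m => rfl)

/-- for `n ≥ 1` there is a short exact sequence
`0 → I_n → R² → I_n → 0`, and consequently `R² ⇒_deg I_n²`,
over `R = k[[x,y]]/(x²)`. -/
theorem In_ses_and_degeneration (k : Type) [Field k] (n : ℕ) (hn : 1 ≤ n) :
    (∃ (f : ↥(In k n) →ₗ[AinfRing k] (Fin 2 → AinfRing k))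
       (g : (Fin 2 → AinfRing k) →ₗ[AinfRing k] ↥(In k n)),
       Function.Injective ⇑f ∧ Function.Surjective ⇑g ∧
       LinearMap.range f = LinearMap.ker g) ∧
    Degenerates k (AinfRing k) (Fin 2 → AinfRing k) (Fin 2 → ↥(In k n)) := by
  obtain ⟨f, g, hf, hg, hfg⟩ := In_ses k n
  haveI := In_finite k n
  exact ⟨⟨f, g, hf, hg, hfg⟩, degenerates_of_ses k (AinfRing k) _ _ _ _ f g hf hg hfg
    (LinearEquiv.finTwoArrow (AinfRing k) ↥(In k n)).symm⟩
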